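/- arXiv:1912.08957 — 3 statements merged into one kernel-verified Lean document; each statement's English description precedes it below -/
import Mathlib

section
/- Let x₁,…,x_n ∈ ℝ^d with ‖xᵢ‖ = 1 for every i, let H = (1/n)Σ_{i=1}^n xᵢxᵢ^T and μ its smallest eigenvalue, let w* ∈ ℝ^d with yᵢ = ⟨xᵢ, w*⟩, and fix an initial point w⁰ ∈ ℝ^d. For an index sequence ι ∈ {1,…,n}^k define iterates w^{t+1}(ι) = w^t(ι) − (⟨x_{ι_t}, w^t(ι)⟩ − y_{ι_t}) x_{ι_t} for t = 0,…,k−1. Then the expectation over ι drawn uniformly and independently (each coordinate uniform on {1,…,n}) satisfies E‖w^k − w*‖² ≤ (1 − μ)^k ‖w⁰ − w*‖². -/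
open scoped MatrixOrder in
/-- The quadratic form of a Hermitian real matrix is bounded below by its smallest eigenvalue. -/
theorem Matrix.IsHermitian.iInf_eigenvalues_mul_le {d : ℕ} {H : Matrix (Fin d) (Fin d) ℝ}
    (hH : H.IsHermitian) (v : Fin d → ℝ) :
    (⨅ a, hH.eigenvalues a) * (v ⬝ᵥ v) ≤ v ⬝ᵥ (H.mulVec v) := by
  have hle : algebraMap ℝ (Matrix (Fin d) (Fin d) ℝ) (⨅ a, hH.eigenvalues a) ≤ H := by
    rw [algebraMap_le_iff_le_spectrum (ha := hH.isSelfAdjoint)]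
    intro r hr
    rw [hH.spectrum_real_eq_range_eigenvalues] at hr
    obtain ⟨a, rfl⟩ := hr
    exact ciInf_le (Set.finite_range _).bddBelow a
  have h := (Matrix.le_iff.mp hle).dotProduct_mulVec_nonneg v
  simpa [Matrix.sub_mulVec, dotProduct_sub, Algebra.algebraMap_eq_smul_one, Matrix.smul_mulVec]
    using h

/-- The quadratic form of an average of rank-one matrices `xᵢxᵢᵀ`. -/
theorem dotProduct_mulVec_smul_sum_vecMulVec {d n : ℕ} (c : ℝ) (x : Fin n → Fin d → ℝ)
    (v : Fin d → ℝ) :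
    v ⬝ᵥ ((c • ∑ i, Matrix.vecMulVec (x i) (x i)).mulVec v) = c * ∑ i, (x i ⬝ᵥ v) ^ 2 := by
  rw [Matrix.smul_mulVec, dotProduct_smul, Matrix.sum_mulVec, dotProduct_sum, smul_eq_mul]
  congr 1
  refine Finset.sum_congr rfl fun i _ => ?_
  simp [Matrix.vecMulVec_mulVec, dotProduct_comm v (x i), sq]

/-- Projecting onto the orthogonal complement of a unit vector, coordinatewise. -/
theorem sum_sq_sub_mul_of_unit {d : ℕ} {u : Fin d → ℝ} (hu : ∑ a, u a ^ 2 = 1)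
    (v : Fin d → ℝ) :
    ∑ a, (v a - (u ⬝ᵥ v) * u a) ^ 2 = ∑ a, v a ^ 2 - (u ⬝ᵥ v) ^ 2 := by
  have h : ∀ a, (v a - (u ⬝ᵥ v) * u a) ^ 2
      = v a ^ 2 - 2 * (u ⬝ᵥ v) * (u a * v a) + (u ⬝ᵥ v) ^ 2 * u a ^ 2 := fun a => by ring
  simp_rw [h, Finset.sum_add_distrib, Finset.sum_sub_distrib, ← Finset.mul_sum, hu]
  change _ - 2 * (u ⬝ᵥ v) * (u ⬝ᵥ v) + _ = _
  ring

/-- If one random step contracts the squared distance by `ρ` on average, then `k` independent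
steps contract it by `ρ ^ k` on average. -/
theorem sum_sq_trajectory_le {d n : ℕ} {ρ : ℝ} (hρ : 0 ≤ ρ) (wstar : Fin d → ℝ)
    (step : Fin n → (Fin d → ℝ) → Fin d → ℝ)
    (hstep : ∀ w, (n : ℝ)⁻¹ * ∑ i, ∑ a, (step i w a - wstar a) ^ 2
      ≤ ρ * ∑ a, (w a - wstar a) ^ 2)
    (k : ℕ) (w0 : Fin d → ℝ) (W : (Fin k → Fin n) → Fin (k + 1) → Fin d → ℝ)
    (hW0 : ∀ ι, W ι 0 = w0)
    (hWs : ∀ ι, ∀ t : Fin k, W ι t.succ = step (ι t) (W ι t.castSucc)) :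
    ((n : ℝ) ^ k)⁻¹ * ∑ ι : Fin k → Fin n, ∑ a, (W ι (Fin.last k) a - wstar a) ^ 2
      ≤ ρ ^ k * ∑ a, (w0 a - wstar a) ^ 2 := by
  induction k generalizing w0 with
  | zero => simp [hW0]
  | succ k ih =>
    have htail : ∀ i, ((n : ℝ) ^ k)⁻¹ * ∑ ι : Fin k → Fin n,
        ∑ a, (W (Fin.cons i ι) (Fin.last (k + 1)) a - wstar a) ^ 2
          ≤ ρ ^ k * ∑ a, (step i w0 a - wstar a) ^ 2 := by
      intro i
      refine ih (step i w0) (fun ι t => W (Fin.cons i ι) t.succ) (fun ι => ?_) fun ι t => ?_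
      · have h := hWs (Fin.cons i ι) 0
        rwa [Fin.cons_zero, Fin.castSucc_zero, hW0] at h
      · have h := hWs (Fin.cons i ι) t.succ
        rwa [Fin.cons_succ, ← Fin.succ_castSucc] at h
    have hsplit : ∑ ι : Fin (k + 1) → Fin n, ∑ a, (W ι (Fin.last (k + 1)) a - wstar a) ^ 2
        = ∑ i, ∑ ι : Fin k → Fin n,
          ∑ a, (W (Fin.cons i ι) (Fin.last (k + 1)) a - wstar a) ^ 2 := by
      rw [← (Fin.consEquiv fun _ => Fin n).sum_comp, Fintype.sum_prod_type]
      rfl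
    calc _ = (n : ℝ)⁻¹ * ∑ i, ((n : ℝ) ^ k)⁻¹ * ∑ ι : Fin k → Fin n,
          ∑ a, (W (Fin.cons i ι) (Fin.last (k + 1)) a - wstar a) ^ 2 := by
          rw [hsplit, ← Finset.mul_sum, pow_succ', mul_inv, mul_assoc]
      _ ≤ (n : ℝ)⁻¹ * ∑ i, ρ ^ k * ∑ a, (step i w0 a - wstar a) ^ 2 := by
          exact mul_le_mul_of_nonneg_left (Finset.sum_le_sum fun i _ => htail i) (by positivity)
      _ = ρ ^ k * ((n : ℝ)⁻¹ * ∑ i, ∑ a, (step i w0 a - wstar a) ^ 2) := by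
          rw [← Finset.mul_sum, mul_left_comm]
      _ ≤ ρ ^ k * (ρ * ∑ a, (w0 a - wstar a) ^ 2) := by
          exact mul_le_mul_of_nonneg_left (hstep w0) (pow_nonneg hρ k)
      _ = ρ ^ (k + 1) * ∑ a, (w0 a - wstar a) ^ 2 := by ring

/-- Linear convergence of SGD with constant stepsize 1 on a realizable least-squares
problem with unit-norm data: the expectation over uniformly random index sequences of
`‖w^k − w*‖²` is at most `(1 − μ)^k‖w⁰ − w*‖²`, where `μ = λ_min((1/n)Σᵢxᵢxᵢᵀ)`. -/
theorem stmt_11 (d n k : ℕ) (hd : 0 < d) (hn : 0 < n)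
    (x : Fin n → Fin d → ℝ) (hx : ∀ i, Real.sqrt (∑ a, x i a ^ 2) = 1)
    (H : Matrix (Fin d) (Fin d) ℝ)
    (hH : H = (n : ℝ)⁻¹ • ∑ i, Matrix.vecMulVec (x i) (x i))
    (hHerm : H.IsHermitian) (μ : ℝ) (hμ : μ = ⨅ a, hHerm.eigenvalues a)
    (wstar : Fin d → ℝ) (y : Fin n → ℝ) (hy : ∀ i, y i = ∑ a, x i a * wstar a)
    (w0 : Fin d → ℝ)
    (W : (Fin k → Fin n) → Fin (k + 1) → Fin d → ℝ)
    (hW0 : ∀ ι, W ι 0 = w0)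
    (hWs : ∀ ι, ∀ t : Fin k, W ι t.succ = fun a =>
      W ι t.castSucc a - ((∑ b, x (ι t) b * W ι t.castSucc b) - y (ι t)) * x (ι t) a) :
    ((n : ℝ) ^ k)⁻¹ * ∑ ι : Fin k → Fin n, ∑ a, (W ι (Fin.last k) a - wstar a) ^ 2
      ≤ (1 - μ) ^ k * ∑ a, (w0 a - wstar a) ^ 2 := by
  have hunit : ∀ i, ∑ a, x i a ^ 2 = 1 := fun i => Real.sqrt_eq_one.mp (hx i)
  have hn' : (n : ℝ) ≠ 0 := Nat.cast_ne_zero.mpr hn.ne'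
  let step : Fin n → (Fin d → ℝ) → Fin d → ℝ :=
    fun i w a => w a - ((∑ b, x i b * w b) - y i) * x i a
  have hstep : ∀ w, (n : ℝ)⁻¹ * ∑ i, ∑ a, (step i w a - wstar a) ^ 2
      ≤ (1 - μ) * ∑ a, (w a - wstar a) ^ 2 := by
    intro w
    have hres : ∀ i a, step i w a - wstar a
        = (w - wstar) a - (x i ⬝ᵥ (w - wstar)) * x i a := by
      intro i a
      simp only [step, hy, dotProduct_sub, Pi.sub_apply]
      simp only [dotProduct]
      ring
    have hray := hHerm.iInf_eigenvalues_mul_le (w - wstar)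
    rw [← hμ] at hray
    simp only [hH] at hray
    rw [dotProduct_mulVec_smul_sum_vecMulVec] at hray
    have hsq : (w - wstar) ⬝ᵥ (w - wstar) = ∑ a, (w - wstar) a ^ 2 := by
      simp [dotProduct, sq]
    rw [hsq] at hray
    simp_rw [hres, sum_sq_sub_mul_of_unit (hunit _), Finset.sum_sub_distrib]
    rw [Finset.sum_const, Finset.card_univ, Fintype.card_fin, nsmul_eq_mul, mul_sub,
      inv_mul_cancel_left₀ hn']
    simp only [Pi.sub_apply] at hray ⊢
    linarith
  have hρ : 0 ≤ 1 - μ := by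
    have hdist : ∑ a, ((wstar + 1) a - wstar a) ^ 2 = (d : ℝ) := by simp
    have h := hstep (wstar + 1)
    rw [hdist] at h
    exact nonneg_of_mul_nonneg_left (le_trans (by positivity) h) (Nat.cast_pos.mpr hd)
  exact sum_sq_trajectory_le hρ wstar step hstep k w0 W hW0 hWs
end

section
/- Let x₁,…,x_n ∈ ℝ^d be nonzero vectors, let M = Σ_{i=1}^n xᵢxᵢ^T with smallest eigenvalue λ_min(M), and let T = Σ_{j=1}^n ‖x_j‖² (= trace M = ‖X‖_F²). Define importance-sampling weights pᵢ = ‖xᵢ‖²/T. Then for every u ∈ ℝ^d, Σ_{i=1}^n pᵢ ‖ u − (⟨xᵢ, u⟩/‖xᵢ‖²) xᵢ ‖² ≤ (1 − λ_min(M)/T) ‖u‖². -/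
open Matrix in
/-- The smallest eigenvalue of a real symmetric matrix bounds its quadratic form from below. -/
theorem Matrix.IsHermitian.iInf_eigenvalues_mul_dotProduct_le {ι : Type*} [Fintype ι]
    [DecidableEq ι] {A : Matrix ι ι ℝ} (hA : A.IsHermitian) (u : ι → ℝ) :
    (⨅ a, hA.eigenvalues a) * (u ⬝ᵥ u) ≤ u ⬝ᵥ A *ᵥ u := by
  have parseval (w : ι → ℝ) : u ⬝ᵥ w =
      ∑ j, (hA.eigenvectorBasis j ⬝ᵥ u) * (hA.eigenvectorBasis j ⬝ᵥ w) := by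
    have h := hA.eigenvectorBasis.sum_inner_mul_inner (WithLp.toLp 2 u) (WithLp.toLp 2 w)
    simp only [EuclideanSpace.inner_eq_star_dotProduct, star_trivial] at h
    rw [dotProduct_comm u w, ← h]
    exact Finset.sum_congr rfl fun j _ => by rw [dotProduct_comm w]
  have eigen (j : ι) : hA.eigenvectorBasis j ⬝ᵥ A *ᵥ u =
      hA.eigenvalues j * (hA.eigenvectorBasis j ⬝ᵥ u) := by
    have hAt : Aᵀ = A := by simpa [IsHermitian] using hA
    rw [dotProduct_mulVec, ← mulVec_transpose, hAt, hA.mulVec_eigenvectorBasis, smul_dotProduct,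
      smul_eq_mul]
  rw [parseval u, parseval (A *ᵥ u), Finset.mul_sum]
  refine Finset.sum_le_sum fun j _ => ?_
  rw [eigen]
  nlinarith [mul_le_mul_of_nonneg_right (ciInf_le (Set.finite_range hA.eigenvalues).bddBelow j)
    (mul_self_nonneg (hA.eigenvectorBasis j ⬝ᵥ u))]

open Matrix in
/-- The quadratic form of `∑ᵢ xᵢxᵢᵀ` is a sum of squares. -/
theorem Matrix.dotProduct_sum_vecMulVec_mulVec {ι κ : Type*} [Fintype ι] [Fintype κ]
    (x : κ → ι → ℝ) (u : ι → ℝ) :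
    u ⬝ᵥ (∑ i, vecMulVec (x i) (x i)) *ᵥ u = ∑ i, (x i ⬝ᵥ u) ^ 2 := by
  rw [sum_mulVec, dotProduct_sum]
  refine Finset.sum_congr rfl fun i _ => ?_
  rw [vecMulVec_mulVec, op_smul_eq_smul, dotProduct_smul, smul_eq_mul, dotProduct_comm u, sq]

/-- Pythagoras for the projection onto the orthogonal complement of `x`, scaled by `‖x‖²`. -/
theorem sum_sq_mul_sum_sq_sub_proj {ι : Type*} [Fintype ι] {x : ι → ℝ}
    (hx : ∑ b, x b ^ 2 ≠ 0) (u : ι → ℝ) :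
    (∑ b, x b ^ 2) * ∑ a, (u a - ((∑ b, x b * u b) / ∑ b, x b ^ 2) * x a) ^ 2 =
      (∑ b, x b ^ 2) * ∑ a, u a ^ 2 - (∑ b, x b * u b) ^ 2 := by
  have expand (c : ℝ) : ∑ a, (u a - c * x a) ^ 2 =
      ∑ a, u a ^ 2 - 2 * c * ∑ a, x a * u a + c ^ 2 * ∑ a, x a ^ 2 := by
    rw [Finset.mul_sum, Finset.mul_sum, ← Finset.sum_sub_distrib, ← Finset.sum_add_distrib]
    exact Finset.sum_congr rfl fun a _ => by ring
  rw [expand]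
  field_simp
  ring

/-- One step of randomized Kaczmarz / importance-sampled SGD with stepsize `1/‖xᵢ‖²`:
with `M = Σᵢxᵢxᵢᵀ`, `T = Σⱼ‖xⱼ‖²` and sampling weights `pᵢ = ‖xᵢ‖²/T`, for every `u`,
`Σᵢ pᵢ‖u − (⟨xᵢ,u⟩/‖xᵢ‖²)xᵢ‖² ≤ (1 − λ_min(M)/T)‖u‖²`. -/
theorem stmt_12 (d n : ℕ) (hd : 0 < d) (hn : 0 < n)
    (x : Fin n → Fin d → ℝ) (hx : ∀ i, x i ≠ 0)
    (M : Matrix (Fin d) (Fin d) ℝ) (hM : M = ∑ i, Matrix.vecMulVec (x i) (x i))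
    (hHerm : M.IsHermitian) (lmin : ℝ) (hlmin : lmin = ⨅ a, hHerm.eigenvalues a)
    (T : ℝ) (hT : T = ∑ j, ∑ a, x j a ^ 2)
    (p : Fin n → ℝ) (hp : ∀ i, p i = (∑ a, x i a ^ 2) / T)
    (u : Fin d → ℝ) :
    ∑ i, p i * ∑ a, (u a - ((∑ b, x i b * u b) / ∑ b, x i b ^ 2) * x i a) ^ 2
      ≤ (1 - lmin / T) * ∑ a, u a ^ 2 := by
  have hpos (i : Fin n) : 0 < ∑ a, x i a ^ 2 := by
    obtain ⟨a, ha⟩ := Function.ne_iff.mp (hx i)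
    exact Finset.sum_pos' (fun b _ => sq_nonneg _) ⟨a, Finset.mem_univ a, sq_pos_of_ne_zero ha⟩
  have hTpos : 0 < T := by
    rw [hT]
    exact Finset.sum_pos (fun i _ => hpos i) ⟨⟨0, hn⟩, Finset.mem_univ _⟩
  have hquad : lmin * ∑ a, u a ^ 2 ≤ ∑ i, (∑ b, x i b * u b) ^ 2 := by
    have h := hHerm.iInf_eigenvalues_mul_dotProduct_le u
    rw [← hlmin] at h
    have hform : dotProduct u (M.mulVec u) = ∑ i, (dotProduct (x i) u) ^ 2 := by
      rw [hM, Matrix.dotProduct_sum_vecMulVec_mulVec]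
    rw [hform] at h
    simpa only [dotProduct, ← sq] using h
  have hsum : ∑ i, p i * ∑ a, (u a - ((∑ b, x i b * u b) / ∑ b, x i b ^ 2) * x i a) ^ 2 =
      (T * ∑ a, u a ^ 2 - ∑ i, (∑ b, x i b * u b) ^ 2) / T := by
    nth_rw 1 [hT]
    rw [Finset.sum_mul, ← Finset.sum_sub_distrib, Finset.sum_div]
    refine Finset.sum_congr rfl fun i _ => ?_
    rw [hp, div_mul_eq_mul_div, sum_sq_mul_sum_sq_sub_proj (hpos i).ne']
  rw [hsum, div_le_iff₀ hTpos]
  calc T * ∑ a, u a ^ 2 - ∑ i, (∑ b, x i b * u b) ^ 2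
      ≤ T * ∑ a, u a ^ 2 - lmin * ∑ a, u a ^ 2 := by gcongr
    _ = (1 - lmin / T) * (∑ a, u a ^ 2) * T := by field_simp
end

section
/- Let f₁,…,f_n : ℝ^P → ℝ be differentiable functions (the per-sample outputs of a parametrized model), y ∈ ℝ^n, and suppose θ : ℝ → ℝ^P is differentiable and satisfies the gradient flow of the quadratic loss Σ_{i=1}^n ½(fᵢ(θ) − yᵢ)², i.e., θ′(t) = −Σ_{i=1}^n (fᵢ(θ(t)) − yᵢ) ∇fᵢ(θ(t)). Then the residual vector r(t) with components rᵢ(t) = fᵢ(θ(t)) − yᵢ is differentiable and satisfies rᵢ′(t) = −Σ_{j=1}^n K_{ij}(t) r_j(t) for every i, where K_{ij}(t) = ⟨∇fᵢ(θ(t)), ∇f_j(θ(t))⟩ is the neural tangent kernel matrix K(t) = G(t)^T G(t), G(t) = (∇f₁(θ(t)),…,∇f_n(θ(t))) ∈ ℝ^{P×n}; in matrix form, r′(t) = −K(t) r(t). -/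
open scoped RealInnerProductSpace

/-- Neural tangent kernel dynamics: if `θ′(t) = −Σᵢ(fᵢ(θ(t)) − yᵢ)∇fᵢ(θ(t))` (gradient flow
of the quadratic loss), then the residuals `rᵢ = fᵢ(θ(t)) − yᵢ` satisfy
`rᵢ′(t) = −Σⱼ K_{ij}(t) rⱼ(t)` with `K_{ij}(t) = ⟨∇fᵢ(θ(t)), ∇fⱼ(θ(t))⟩`; in matrix form
`r′(t) = −K(t) r(t)`. -/
theorem stmt_19 (P n : ℕ) (f : Fin n → EuclideanSpace ℝ (Fin P) → ℝ)
    (hf : ∀ i, Differentiable ℝ (f i))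
    (y : Fin n → ℝ) (θ : ℝ → EuclideanSpace ℝ (Fin P))
    (hθ : ∀ t, HasDerivAt θ (-∑ i, (f i (θ t) - y i) • gradient (f i) (θ t)) t) :
    (∀ i, ∀ t : ℝ, HasDerivAt (fun s => f i (θ s) - y i)
        (-∑ j, ⟪gradient (f i) (θ t), gradient (f j) (θ t)⟫ * (f j (θ t) - y j)) t)
    ∧ ∀ t : ℝ, HasDerivAt (fun s => fun i => f i (θ s) - y i)
        (-(Matrix.of fun i j => ⟪gradient (f i) (θ t), gradient (f j) (θ t)⟫).mulVec
          (fun j => f j (θ t) - y j)) t := by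
  have residual_deriv : ∀ i, ∀ t : ℝ, HasDerivAt (fun s => f i (θ s) - y i)
      (-∑ j, ⟪gradient (f i) (θ t), gradient (f j) (θ t)⟫ * (f j (θ t) - y j)) t := by
    intro i t
    have h := ((hf i (θ t)).hasGradientAt.hasFDerivAt.comp_hasDerivAt t (hθ t)).sub_const (y i)
    refine h.congr_deriv ?_
    rw [InnerProductSpace.toDual_apply_apply, inner_neg_right, inner_sum]
    simp only [real_inner_smul_right, mul_comm]
  exact ⟨residual_deriv, fun t => hasDerivAt_pi.2 fun i => residual_deriv i t⟩
end
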